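/- arXiv:1804.07499 — 5 statements merged into one kernel-verified Lean document; each statement's English description precedes it below -/
import Mathlib

section
/- Let (X, Π, 𝓑) be a system of d-boxes such that Π_i is complete for every i ∈ {1,…,d}. Then every subfamily 𝓖 ⊆ 𝓑 that is a partition of X satisfies Keller's condition: for all distinct K, L ∈ 𝓖 there is i such that K_i and L_i are distinct parts of one partition π ∈ Π_i. -/
open Set

/-- A partition of a type `α`: a family of nonempty pairwise disjoint subsets whose union
is everything. -/
def IsPartition {α : Type*} (π : Set (Set α)) : Prop :=
  (∀ A ∈ π, A.Nonempty) ∧ π.PairwiseDisjoint id ∧ ⋃₀ π = Set.univ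

/-- `Coarser π ρ` means `ρ` is coarser than `π`: every part of `π` lies in a part of `ρ`. -/
def Coarser {α : Type*} (π ρ : Set (Set α)) : Prop :=
  ∀ A ∈ π, ∃ B ∈ ρ, A ⊆ B

/-- Two partitions are independent if the only partition coarser than both is the trivial
partition `{univ}`. -/
def IndepPartitions {α : Type*} (π π' : Set (Set α)) : Prop :=
  ∀ ρ : Set (Set α), IsPartition ρ → Coarser π ρ → Coarser π' ρ → ρ = {Set.univ}

/-- A system of `d`-boxes: each `X i` has at least two elements, and `P i` is a finite
family of pairwise independent finite partitions of `X i`. -/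
def IsBoxSystem {d : ℕ} (X : Fin d → Type*) (P : ∀ i, Set (Set (Set (X i)))) : Prop :=
  (∀ i, Nontrivial (X i)) ∧ (∀ i, (P i).Finite) ∧ (∀ i, ∀ π ∈ P i, π.Finite) ∧
    (∀ i, ∀ π ∈ P i, IsPartition π) ∧
    (∀ i, ∀ π ∈ P i, ∀ π' ∈ P i, π ≠ π' → IndepPartitions π π')

/-- `K` is a box: every factor `K i` is a part of some partition in `P i`. -/
def IsBox {d : ℕ} {X : Fin d → Type*} (P : ∀ i, Set (Set (Set (X i))))
    (K : ∀ i, Set (X i)) : Prop :=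
  ∀ i, ∃ π ∈ P i, K i ∈ π

/-- The subset of `X` determined by the box `K`. -/
def boxSet {d : ℕ} {X : Fin d → Type*} (K : ∀ i, Set (X i)) : Set (∀ i, X i) :=
  Set.univ.pi K

/-- Keller's condition for a pair of boxes: in some coordinate the factors are distinct
parts of one partition. -/
def KellerPair {d : ℕ} {X : Fin d → Type*} (P : ∀ i, Set (Set (Set (X i))))
    (K L : ∀ i, Set (X i)) : Prop :=
  ∃ i, ∃ π ∈ P i, K i ∈ π ∧ L i ∈ π ∧ K i ≠ L i

/-- A Keller family: a nonempty family of boxes any two distinct members of which satisfy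
Keller's condition. -/
def IsKellerFamily {d : ℕ} {X : Fin d → Type*} (P : ∀ i, Set (Set (Set (X i))))
    (G : Set (∀ i, Set (X i))) : Prop :=
  G.Nonempty ∧ (∀ K ∈ G, IsBox P K) ∧ ∀ K ∈ G, ∀ L ∈ G, K ≠ L → KellerPair P K L

/-- The union (polybox) of a family of boxes. -/
def polyUnion {d : ℕ} {X : Fin d → Type*} (G : Set (∀ i, Set (X i))) : Set (∀ i, X i) :=
  ⋃ K ∈ G, boxSet K

/-- The restriction `𝓖|𝓥 = {K ∈ 𝓖 : K i ∈ 𝓥}`. -/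
def restrictFam {d : ℕ} {X : Fin d → Type*} (G : Set (∀ i, Set (X i))) (i : Fin d)
    (V : Set (Set (X i))) : Set (∀ i, Set (X i)) :=
  {K ∈ G | K i ∈ V}

/-- An `i`-cylinder: together with any point it contains the whole line through that point
in direction `i`. -/
def IsCylinder {d : ℕ} {X : Fin d → Type*} (i : Fin d) (W : Set (∀ j, X j)) : Prop :=
  ∀ x ∈ W, ∀ y : X i, Function.update x i y ∈ W

/-- `π` is present in `𝓖` if some box of `𝓖` has its `i`-th factor in `π`. -/
def PresentIn {d : ℕ} {X : Fin d → Type*} (G : Set (∀ i, Set (X i))) (i : Fin d)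
    (π : Set (Set (X i))) : Prop :=
  ∃ K ∈ G, K i ∈ π

/-- A nontrivial partition `π ∈ P i` is hidden in `𝓖` if `𝓖|π` is a suit for an
`i`-cylinder. -/
def HiddenIn {d : ℕ} {X : Fin d → Type*} (P : ∀ i, Set (Set (Set (X i))))
    (G : Set (∀ i, Set (X i))) (i : Fin d) (π : Set (Set (X i))) : Prop :=
  π ∈ P i ∧ π ≠ {Set.univ} ∧ IsKellerFamily P (restrictFam G i π) ∧
    IsCylinder i (polyUnion (restrictFam G i π))

/-- A nontrivial partition `π ∈ P i` is exposed in `𝓖` if it is present and not hidden. -/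
def ExposedIn {d : ℕ} {X : Fin d → Type*} (P : ∀ i, Set (Set (Set (X i))))
    (G : Set (∀ i, Set (X i))) (i : Fin d) (π : Set (Set (X i))) : Prop :=
  π ∈ P i ∧ π ≠ {Set.univ} ∧ PresentIn G i π ∧ ¬ HiddenIn P G i π

/-- A family of partitions is complete if every partition all of whose parts belong to
the union of the family is itself a member of the family. -/
def CompletePartitionFamily {α : Type*} (P : Set (Set (Set α))) : Prop :=
  ∀ ρ : Set (Set α), IsPartition ρ → (∀ A ∈ ρ, ∃ π ∈ P, A ∈ π) → ρ ∈ P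

theorem part_unique_aux {α : Type*} {π π' : Set (Set α)} (h : IsPartition π)
    (h' : IsPartition π') (hind : π ≠ π' → IndepPartitions π π') {A : Set α}
    (hA : A ∈ π) (hA' : A ∈ π') : π = π' := by
  by_cases hu : A = Set.univ
  · have key : ∀ σ : Set (Set α), IsPartition σ → A ∈ σ → σ = {Set.univ} := by
      intro σ hσ hAσ
      subst hu
      apply Set.Subset.antisymm
      · intro B hB
        by_contra hne
        have hd : Disjoint B Set.univ := hσ.2.1 hB hAσ hne
        have hn := hσ.1 B hB
        rw [disjoint_univ] at hd
        exact hn.ne_empty hd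
      · rintro B rfl
        exact hAσ
    rw [key π h hA, key π' h' hA']
  · by_contra hne
    have hc : ∀ σ : Set (Set α), IsPartition σ → A ∈ σ →
        Coarser σ {A, Aᶜ} := by
      intro σ hσ hAσ B hB
      by_cases hBA : B = A
      · exact ⟨A, by simp, hBA.subset⟩
      · have hd : Disjoint B A := hσ.2.1 hB hAσ hBA
        exact ⟨Aᶜ, by simp, hd.subset_compl_right⟩
    have hp : IsPartition ({A, Aᶜ} : Set (Set α)) := by
      refine ⟨?_, ?_, ?_⟩
      · rintro B (rfl | rfl)
        · exact h.1 _ hA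
        · exact Set.nonempty_compl.2 hu
      · rintro B (rfl | rfl) C (rfl | rfl) hBC
        · exact absurd rfl hBC
        · exact disjoint_compl_right
        · exact disjoint_compl_left
        · exact absurd rfl hBC
      · simp
    have he := hind hne _ hp (hc π h hA) (hc π' h' hA')
    have : A ∈ ({A, Aᶜ} : Set (Set α)) := by simp
    rw [he] at this
    exact hu this

/-- Main step: one may replace points by arbitrary selectors of parts, coordinate by
coordinate. -/
theorem selector_aux {d : ℕ} {X : Fin d → Type*} (P : ∀ i, Set (Set (Set (X i))))
    (hpart : ∀ i, ∀ π ∈ P i, IsPartition π)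
    (hcomp : ∀ i, CompletePartitionFamily (P i))
    (G : Set (∀ i, Set (X i)))
    (hbox : ∀ K ∈ G, IsBox P K)
    (hbase : ∀ x : ∀ i, X i, ∃! K, K ∈ G ∧ ∀ i, x i ∈ K i) (T : Finset (Fin d)) :
    ∀ s : ∀ i, Set (Set (X i)),
      (∀ i ∈ T, ∀ π ∈ P i, ∃! A, A ∈ π ∧ A ∈ s i) →
      (∀ i, i ∉ T → ∃ x : X i, s i = {A | x ∈ A}) →
      ∃! K, K ∈ G ∧ ∀ i, K i ∈ s i := by
  classical
  induction T using Finset.induction_on with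
  | empty =>
    intro s _ hs
    choose x hx using fun i => hs i (Finset.notMem_empty i)
    have := hbase x
    simpa [hx] using this
  | insert a T ha ih =>
    intro s hgood hpt
    -- replace the selector at `a` by a point
    have hstep : ∀ x : X a, ∃! K, K ∈ G ∧ x ∈ K a ∧ ∀ j, j ≠ a → K j ∈ s j := by
      intro x
      have h1 := ih (Function.update s a {A | x ∈ A})
        (by
          intro i hi
          have hia : i ≠ a := fun h => ha (h ▸ hi)
          rw [Function.update_of_ne hia]
          exact hgood i (Finset.mem_insert_of_mem hi))
        (by
          intro i hi
          by_cases hia : i = a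
          · subst hia
            exact ⟨x, by simp⟩
          · rw [Function.update_of_ne hia]
            exact hpt i (by simp [hia, hi]))
      have heq : ∀ K : ∀ i, Set (X i),
          (∀ i, K i ∈ Function.update s a {A | x ∈ A} i) ↔
            (x ∈ K a ∧ ∀ j, j ≠ a → K j ∈ s j) := by
        intro K
        constructor
        · intro h
          refine ⟨by simpa using h a, fun j hj => ?_⟩
          have := h j
          rwa [Function.update_of_ne hj] at this
        · rintro ⟨h2, h3⟩ i
          by_cases hia : i = a
          · subst hia
            simpa using h2
          · rw [Function.update_of_ne hia]
            exact h3 i hia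
      simpa only [heq] using h1
    have hne : ∀ K ∈ G, (K a).Nonempty := by
      intro K hK
      obtain ⟨π, hπ, hm⟩ := hbox K hK a
      exact (hpart a π hπ).1 _ hm
    let ρ : Set (Set (X a)) := {A | ∃ K ∈ G, (∀ j, j ≠ a → K j ∈ s j) ∧ K a = A}
    have hρ : IsPartition ρ := by
      refine ⟨?_, ?_, ?_⟩
      · rintro A ⟨K, hK, -, rfl⟩
        exact hne K hK
      · rintro A ⟨K, hK, hKs, rfl⟩ B ⟨L, hL, hLs, rfl⟩ hAB
        refine Set.disjoint_left.2 fun x hx hx' => hAB ?_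
        rw [(hstep x).unique ⟨hK, hx, hKs⟩ ⟨hL, hx', hLs⟩]
      · refine Set.eq_univ_of_forall fun x => ?_
        obtain ⟨K, ⟨hK, hx, hKs⟩, -⟩ := hstep x
        exact ⟨K a, ⟨K, hK, hKs, rfl⟩, hx⟩
    have hρP : ρ ∈ P a := by
      apply hcomp a ρ hρ
      rintro A ⟨K, hK, -, rfl⟩
      exact hbox K hK a
    have hex := hgood a (Finset.mem_insert_self a T) ρ hρP
    obtain ⟨A, ⟨⟨K, hK, hKs, rfl⟩, hA⟩, -⟩ := id hex
    refine ⟨K, ⟨hK, fun i => ?_⟩, ?_⟩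
    · by_cases hia : i = a
      · subst hia
        exact hA
      · exact hKs i hia
    · rintro L ⟨hL, hLs⟩
      have hLK : L a = K a :=
        hex.unique ⟨⟨L, hL, fun j _ => hLs j, rfl⟩, hLs a⟩ ⟨⟨K, hK, hKs, rfl⟩, hA⟩
      obtain ⟨x, hx⟩ := hne K hK
      exact (hstep x).unique ⟨hL, hLK ▸ hx, fun j _ => hLs j⟩ ⟨hK, hx, hKs⟩

theorem stmt_2 {d : ℕ} {X : Fin d → Type*} (P : ∀ i, Set (Set (Set (X i))))
    (hsys : IsBoxSystem X P) (hcomp : ∀ i, CompletePartitionFamily (P i))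
    (G : Set (∀ i, Set (X i)))
    (hbox : ∀ K ∈ G, IsBox P K)
    (hdisj : ∀ K ∈ G, ∀ L ∈ G, K ≠ L → Disjoint (boxSet K) (boxSet L))
    (hcover : ⋃ K ∈ G, boxSet K = Set.univ) :
    ∀ K ∈ G, ∀ L ∈ G, K ≠ L → KellerPair P K L := by
  classical
  obtain ⟨hnt, -, -, hpart, hind⟩ := hsys
  have hbase : ∀ x : ∀ i, X i, ∃! K, K ∈ G ∧ ∀ i, x i ∈ K i := by
    intro x
    have hx : x ∈ ⋃ K ∈ G, boxSet K := hcover ▸ Set.mem_univ x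
    simp only [Set.mem_iUnion] at hx
    obtain ⟨K, hK, hxK⟩ := hx
    refine ⟨K, ⟨hK, fun i => hxK i (Set.mem_univ i)⟩, ?_⟩
    rintro L ⟨hL, hxL⟩
    by_contra hne
    exact Set.disjoint_left.1 (hdisj L hL K hK hne) (fun i _ => hxL i) hxK
  intro K hK L hL hKL
  by_contra hnk
  have hsel : ∀ i, ∃ s : Set (Set (X i)),
      (∀ π ∈ P i, ∃! A, A ∈ π ∧ A ∈ s) ∧ K i ∈ s ∧ L i ∈ s := by
    intro i
    have hf : ∀ π : Set (Set (X i)), ∃ A : Set (X i), π ∈ P i →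
        A ∈ π ∧ (K i ∈ π → A = K i) ∧ (L i ∈ π → A = L i) := by
      intro π
      by_cases hπ : π ∈ P i
      · by_cases h1 : K i ∈ π
        · refine ⟨K i, fun _ => ⟨h1, fun _ => rfl, fun h2 => ?_⟩⟩
          by_contra hne
          exact hnk ⟨i, π, hπ, h1, h2, hne⟩
        · by_cases h2 : L i ∈ π
          · exact ⟨L i, fun _ => ⟨h2, fun h => absurd h h1, fun _ => rfl⟩⟩
          · haveI := hnt i
            obtain ⟨x⟩ : Nonempty (X i) := inferInstance
            have hx : x ∈ ⋃₀ π := (hpart i π hπ).2.2 ▸ Set.mem_univ x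
            obtain ⟨A, hA, -⟩ := hx
            exact ⟨A, fun _ => ⟨hA, fun h => absurd h h1, fun h => absurd h h2⟩⟩
      · exact ⟨∅, fun h => absurd h hπ⟩
    choose f hf using hf
    refine ⟨{A | ∃ π ∈ P i, f π = A}, ?_, ?_, ?_⟩
    · intro π hπ
      refine ⟨f π, ⟨(hf π hπ).1, π, hπ, rfl⟩, ?_⟩
      rintro A ⟨hA, π', hπ', rfl⟩
      rw [part_unique_aux (hpart i π hπ) (hpart i π' hπ') (hind i π hπ π' hπ') hA
        (hf π' hπ').1]
    · obtain ⟨π, hπ, hm⟩ := hbox K hK i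
      exact ⟨π, hπ, (hf π hπ).2.1 hm⟩
    · obtain ⟨π, hπ, hm⟩ := hbox L hL i
      exact ⟨π, hπ, (hf π hπ).2.2 hm⟩
  choose s hs hKs hLs using hsel
  exact hKL ((selector_aux P hpart hcomp G hbox hbase Finset.univ s (fun i _ => hs i)
    (fun i hi => absurd (Finset.mem_univ i) hi)).unique ⟨hK, hKs⟩ ⟨hL, hLs⟩)
end

section
/- Let (X, Π, 𝓑) be a system of d-boxes and let 𝓖, 𝓖' ⊆ 𝓑 be two suits for the same polybox G. If a nontrivial partition π ∈ Π_i is exposed in 𝓖, then π is exposed in 𝓖'. -/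
open Set

theorem mem_polyUnion_iff {d : ℕ} {X : Fin d → Type*} (G : Set (∀ i, Set (X i)))
    (x : ∀ i, X i) : x ∈ polyUnion G ↔ ∃ K ∈ G, ∀ j, x j ∈ K j := by
  simp [polyUnion, boxSet]

theorem part_eq {α : Type*} {π : Set (Set α)} (h : IsPartition π) {A B : Set α}
    (hA : A ∈ π) (hB : B ∈ π) {a : α} (ha : a ∈ A) (hb : a ∈ B) : A = B := by
  by_contra hne
  exact Set.disjoint_left.mp (h.2.1 hA hB hne) ha hb

theorem pair_isPartition {α : Type*} {S : Set α} {a b : α} (ha : a ∈ S) (hb : b ∉ S) :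
    IsPartition ({S, Sᶜ} : Set (Set α)) := by
  refine ⟨?_, ?_, ?_⟩
  · rintro A (rfl | rfl)
    · exact ⟨a, ha⟩
    · exact ⟨b, hb⟩
  · rintro A (rfl | rfl) B (rfl | rfl) hne
    · exact absurd rfl hne
    · exact disjoint_compl_right
    · exact disjoint_compl_left
    · exact absurd rfl hne
  · simp

/-- If `S` is a proper nonempty union of parts of two partitions of the family,
they are equal. -/
theorem eq_of_saturated {α : Type*} {π π' : Set (Set α)}
    (hind : π ≠ π' → IndepPartitions π π') {S : Set α} {a b : α}
    (ha : a ∈ S) (hb : b ∉ S)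
    (h : ∀ A ∈ π, ∀ t ∈ A, t ∈ S → A ⊆ S)
    (h' : ∀ A ∈ π', ∀ t ∈ A, t ∈ S → A ⊆ S) : π = π' := by
  by_contra hne
  have key : ∀ σ : Set (Set α), (∀ A ∈ σ, ∀ t ∈ A, t ∈ S → A ⊆ S) →
      Coarser σ ({S, Sᶜ} : Set (Set α)) := by
    intro σ hσ A hA
    by_cases hs : ∃ t ∈ A, t ∈ S
    · obtain ⟨t, ht, hts⟩ := hs
      exact ⟨S, Or.inl rfl, hσ A hA t ht hts⟩
    · exact ⟨Sᶜ, Or.inr rfl, fun t ht hts => hs ⟨t, ht, hts⟩⟩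
  have hρ := hind hne _ (pair_isPartition ha hb) (key π h) (key π' h')
  have hS : S ∈ ({Set.univ} : Set (Set α)) := hρ ▸ Or.inl rfl
  have hS' : S = Set.univ := hS
  exact hb (hS' ▸ Set.mem_univ b)

theorem partition_unique {α : Type*} {π π' : Set (Set α)} (hp : IsPartition π)
    (hp' : IsPartition π') (hind : π ≠ π' → IndepPartitions π π') {A : Set α}
    (hA : A ∈ π) (hA' : A ∈ π') (hu : A ≠ Set.univ) : π = π' := by
  obtain ⟨a, ha⟩ := hp.1 A hA
  obtain ⟨b, hb⟩ := (Set.ne_univ_iff_exists_notMem A).mp hu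
  refine eq_of_saturated hind ha hb ?_ ?_
  · intro B hB t ht hts
    rw [part_eq hp hB hA ht hts]
  · intro B hB t ht hts
    rw [part_eq hp' hB hA' ht hts]

/-- Boxes of a Keller family meeting a line in direction `i` have `i`-th factors in one
partition. -/
theorem line_part {d : ℕ} {X : Fin d → Type*} {P : ∀ i, Set (Set (Set (X i)))}
    (hsys : IsBoxSystem X P) {G : Set (∀ i, Set (X i))} (hG : IsKellerFamily P G)
    {i : Fin d} {π : Set (Set (X i))} (hπ : π ∈ P i) {K L : ∀ i, Set (X i)}
    (hK : K ∈ G) (hL : L ∈ G) (hKπ : K i ∈ π) (hu : K i ≠ Set.univ)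
    {x : ∀ i, X i} (hx : ∀ j, x j ∈ K j) {t : X i}
    (ht : ∀ j, Function.update x i t j ∈ L j) : L i ∈ π := by
  obtain ⟨-, -, -, hpart, hind⟩ := hsys
  by_cases hKL : K = L
  · rw [← hKL]; exact hKπ
  obtain ⟨j, σ, hσ, h1, h2, hne⟩ := hG.2.2 K hK L hL hKL
  by_cases hj : j = i
  · subst hj
    have : π = σ := partition_unique (hpart j π hπ) (hpart j σ hσ)
      (hind j π hπ σ hσ) hKπ h1 hu
    rw [this]; exact h2
  · have h3 := ht j
    rw [Function.update_of_ne hj] at h3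
    exact absurd (part_eq (hpart j σ hσ) h1 h2 (hx j) h3) hne

theorem line_saturated {d : ℕ} {X : Fin d → Type*} {P : ∀ i, Set (Set (Set (X i)))}
    (hsys : IsBoxSystem X P) {G : Set (∀ i, Set (X i))} (hG : IsKellerFamily P G)
    {i : Fin d} {π : Set (Set (X i))} (hπ : π ∈ P i) {K : ∀ i, Set (X i)}
    (hK : K ∈ G) (hKπ : K i ∈ π) (hu : K i ≠ Set.univ)
    {x : ∀ i, X i} (hx : ∀ j, x j ∈ K j) :
    ∀ A ∈ π, ∀ t ∈ A, t ∈ {t | Function.update x i t ∈ polyUnion G} →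
      A ⊆ {t | Function.update x i t ∈ polyUnion G} := by
  intro A hA t ht hts s hs
  obtain ⟨L, hL, hLt⟩ := (mem_polyUnion_iff _ _).mp hts
  have hLπ := line_part hsys hG hπ hK hL hKπ hu hx hLt
  have hti : t ∈ L i := by simpa using hLt i
  have hAL : A = L i := part_eq (hsys.2.2.2.1 i π hπ) hA hLπ ht hti
  refine (mem_polyUnion_iff _ _).mpr ⟨L, hL, fun j => ?_⟩
  by_cases hj : j = i
  · subst hj
    simpa [← hAL] using hs
  · have := hLt j
    rw [Function.update_of_ne hj] at this ⊢
    exact this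

theorem stmt_3 {d : ℕ} {X : Fin d → Type*} (P : ∀ i, Set (Set (Set (X i))))
    (hsys : IsBoxSystem X P)
    (G G' : Set (∀ i, Set (X i)))
    (hG : IsKellerFamily P G) (hG' : IsKellerFamily P G')
    (hsame : polyUnion G = polyUnion G')
    (i : Fin d) (π : Set (Set (X i)))
    (hexp : ExposedIn P G i π) :
    ExposedIn P G' i π := by
  obtain ⟨hπ, hnt, ⟨K₀, hK₀, hK₀π⟩, hnh⟩ := hexp
  have hpart := hsys.2.2.2.1 i
  have hind := hsys.2.2.2.2 i
  have hnc : ¬ IsCylinder i (polyUnion (restrictFam G i π)) := fun hc =>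
    hnh ⟨hπ, hnt, ⟨⟨K₀, hK₀, hK₀π⟩, fun K hK => hG.2.1 K hK.1,
      fun K hK L hL => hG.2.2 K hK.1 L hL.1⟩, hc⟩
  unfold IsCylinder at hnc
  push Not at hnc
  obtain ⟨x, hx, y, hy⟩ := hnc
  obtain ⟨K, ⟨hK, hKπ⟩, hxK⟩ := (mem_polyUnion_iff _ _).mp hx
  have hu : K i ≠ Set.univ := by
    intro hKu
    apply hnt
    rw [hKu] at hKπ
    ext A
    constructor
    · intro hA
      obtain ⟨a, ha⟩ := (hpart π hπ).1 A hA
      exact part_eq (hpart π hπ) hA hKπ ha (Set.mem_univ a)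
    · intro hA
      rw [Set.mem_singleton_iff.mp hA]; exact hKπ
  have hyG : Function.update x i y ∉ polyUnion G := by
    intro h
    obtain ⟨L, hL, hLy⟩ := (mem_polyUnion_iff _ _).mp h
    exact hy ((mem_polyUnion_iff _ _).mpr
      ⟨L, ⟨hL, line_part hsys hG hπ hK hL hKπ hu hxK hLy⟩, hLy⟩)
  have hxG : x ∈ polyUnion G := (mem_polyUnion_iff _ _).mpr ⟨K, hK, hxK⟩
  have hyG' := hyG
  rw [hsame] at hyG'
  obtain ⟨K', hK', hxK'⟩ := (mem_polyUnion_iff _ _).mp (hsame ▸ hxG)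
  obtain ⟨π', hπ', hKπ'⟩ := hG'.2.1 K' hK' i
  have hu' : K' i ≠ Set.univ := by
    intro hKu
    apply hyG'
    refine (mem_polyUnion_iff _ _).mpr ⟨K', hK', fun j => ?_⟩
    by_cases hj : j = i
    · subst hj; rw [hKu]; exact Set.mem_univ _
    · rw [Function.update_of_ne hj]; exact hxK' j
  have h1 := line_saturated hsys hG hπ hK hKπ hu hxK
  have h2 := line_saturated hsys hG' hπ' hK' hKπ' hu' hxK'
  rw [← hsame] at h2
  have heq : π = π' := eq_of_saturated (a := x i) (b := y) (hind π hπ π' hπ')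
    (by simpa using hxG) hyG h1 h2
  subst heq
  refine ⟨hπ, hnt, ⟨K', hK', hKπ'⟩, fun hhid => hyG' ?_⟩
  have := hhid.2.2.2 x ((mem_polyUnion_iff _ _).mpr ⟨K', ⟨hK', hKπ'⟩, hxK'⟩) y
  obtain ⟨L, hL, hLy⟩ := (mem_polyUnion_iff _ _).mp this
  exact (mem_polyUnion_iff _ _).mpr ⟨L, hL.1, hLy⟩
end

section
/- Let (X, Π, 𝓑) be a system of d-boxes and let 𝓖, 𝓖' ⊆ 𝓑 be two suits for the same polybox G. If a nontrivial partition π ∈ Π_i is hidden in 𝓖 and present in 𝓖', then π is hidden in 𝓖'. -/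
open Set

theorem indep_eq {α : Type*} {π σ : Set (Set α)} (h : π ≠ σ → IndepPartitions π σ)
    (F : Set α) (hne : F.Nonempty) (hun : F ≠ Set.univ)
    (h1 : ∀ A ∈ π, A ⊆ F ∨ A ⊆ Fᶜ) (h2 : ∀ A ∈ σ, A ⊆ F ∨ A ⊆ Fᶜ) : π = σ := by
  by_contra hc
  have hp : IsPartition ({F, Fᶜ} : Set (Set α)) := by
    refine ⟨?_, ?_, ?_⟩
    · rintro A (rfl | rfl)
      · exact hne
      · exact Set.nonempty_compl.2 hun
    · rintro A (rfl | rfl) B (rfl | rfl) hAB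
      · exact absurd rfl hAB
      · exact disjoint_compl_right
      · exact disjoint_compl_left
      · exact absurd rfl hAB
    · simp
  have hco : ∀ τ : Set (Set α), (∀ A ∈ τ, A ⊆ F ∨ A ⊆ Fᶜ) → Coarser τ {F, Fᶜ} := by
    intro τ hτ A hA
    rcases hτ A hA with h | h
    · exact ⟨F, by simp, h⟩
    · exact ⟨Fᶜ, by simp, h⟩
  have he := h hc _ hp (hco _ h1) (hco _ h2)
  have : F ∈ ({F, Fᶜ} : Set (Set α)) := by simp
  rw [he] at this
  exact hun this

theorem part_sub {α : Type*} {π : Set (Set α)} (hπ : IsPartition π) (F : Set α)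
    (h : ∀ z ∈ F, ∃ B ∈ π, z ∈ B ∧ B ⊆ F) : ∀ A ∈ π, A ⊆ F ∨ A ⊆ Fᶜ := by
  intro A hA
  by_cases hd : ∃ z ∈ A, z ∈ F
  · obtain ⟨z, hzA, hzF⟩ := hd
    obtain ⟨B, hB, hzB, hBF⟩ := h z hzF
    left
    have : A = B := by
      by_contra hne
      exact Set.disjoint_left.1 (hπ.2.1 hA hB hne) hzA hzB
    exact this ▸ hBF
  · right
    intro z hz hzF
    exact hd ⟨z, hz, hzF⟩

theorem fiber_part {d : ℕ} {X : Fin d → Type*} {P : ∀ i, Set (Set (Set (X i)))}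
    (hsys : IsBoxSystem X P) {G : Set (∀ i, Set (X i))} (hG : IsKellerFamily P G)
    {i : Fin d} {π : Set (Set (X i))} (hπ : π ∈ P i) {x : ∀ i, X i}
    {K L : ∀ i, Set (X i)} (hK : K ∈ G) (hxK : x ∈ boxSet K) (hKπ : K i ∈ π)
    (hL : L ∈ G) (z : X i) (hz : Function.update x i z ∈ boxSet L) : L i ∈ π := by
  obtain ⟨-, -, -, hpart, hind⟩ := hsys
  by_cases hKL : K = L
  · exact hKL ▸ hKπ
  obtain ⟨j, σ, hσ, h1, h2, hne⟩ := hG.2.2 K hK L hL hKL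
  have hdis : Disjoint (K j) (L j) := (hpart j σ hσ).2.1 h1 h2 hne
  by_cases hj : j = i
  · subst hj
    have hun : K j ≠ Set.univ := by
      intro h
      have := hz j (Set.mem_univ _)
      exact Set.disjoint_left.1 hdis (h ▸ Set.mem_univ _) this
    have hs : ∀ τ ∈ P j, K j ∈ τ → ∀ A ∈ τ, A ⊆ K j ∨ A ⊆ (K j)ᶜ := fun τ hτ hm =>
      part_sub (hpart j τ hτ) _ fun w hw => ⟨K j, hm, hw, subset_rfl⟩
    have : π = σ := indep_eq (hind j π hπ σ hσ) (K j) ⟨x j, hxK j (Set.mem_univ _)⟩ hun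
      (hs π hπ hKπ) (hs σ hσ h1)
    exact this ▸ h2
  · have := hz j (Set.mem_univ _)
    rw [Function.update_of_ne hj] at this
    exact absurd this (Set.disjoint_left.1 hdis (hxK j (Set.mem_univ _)))

theorem mem_polyUnion' {d : ℕ} {X : Fin d → Type*} {G : Set (∀ i, Set (X i))}
    {x : ∀ i, X i} : x ∈ polyUnion G ↔ ∃ K ∈ G, x ∈ boxSet K := by
  simp [polyUnion]

theorem fiber_cut {d : ℕ} {X : Fin d → Type*} {P : ∀ i, Set (Set (Set (X i)))}
    (hsys : IsBoxSystem X P) {G : Set (∀ i, Set (X i))} (hG : IsKellerFamily P G)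
    {i : Fin d} {π : Set (Set (X i))} (hπ : π ∈ P i) {x : ∀ i, X i}
    {K : ∀ i, Set (X i)} (hK : K ∈ G) (hxK : x ∈ boxSet K) (hKπ : K i ∈ π) :
    ∀ A ∈ π, A ⊆ {z | Function.update x i z ∈ polyUnion G} ∨
      A ⊆ {z | Function.update x i z ∈ polyUnion G}ᶜ := by
  apply part_sub (hsys.2.2.2.1 i π hπ)
  intro z hz
  obtain ⟨L, hL, hzL⟩ := mem_polyUnion'.1 hz
  refine ⟨L i, fiber_part hsys hG hπ hK hxK hKπ hL z hzL, ?_, ?_⟩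
  · simpa using hzL i (Set.mem_univ _)
  · intro w hw
    refine mem_polyUnion'.2 ⟨L, hL, ?_⟩
    intro j _
    by_cases hj : j = i
    · subst hj
      simpa using hw
    · have := hzL j (Set.mem_univ _)
      rw [Function.update_of_ne hj] at this ⊢
      exact this

theorem stmt_4 {d : ℕ} {X : Fin d → Type*} (P : ∀ i, Set (Set (Set (X i))))
    (hsys : IsBoxSystem X P)
    (G G' : Set (∀ i, Set (X i)))
    (hG : IsKellerFamily P G) (hG' : IsKellerFamily P G')
    (hsame : polyUnion G = polyUnion G')
    (i : Fin d) (π : Set (Set (X i)))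
    (hhid : HiddenIn P G i π) (hpres : PresentIn G' i π) :
    HiddenIn P G' i π := by
  obtain ⟨hπ, hnt, -, hcyl⟩ := hhid
  obtain ⟨K₀, hK₀, hK₀π⟩ := hpres
  refine ⟨hπ, hnt, ⟨⟨K₀, hK₀, hK₀π⟩, fun K hK => hG'.2.1 K hK.1,
    fun K hK L hL => hG'.2.2 K hK.1 L hL.1⟩, ?_⟩
  intro x hx y
  obtain ⟨K, ⟨hK, hKπ⟩, hxK⟩ := mem_polyUnion'.1 hx
  have hxG : x ∈ polyUnion G := hsame ▸ mem_polyUnion'.2 ⟨K, hK, hxK⟩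
  obtain ⟨M, hM, hxM⟩ := mem_polyUnion'.1 hxG
  obtain ⟨σ, hσ, hMσ⟩ := hG.2.1 M hM i
  have c1 := fiber_cut hsys hG' hπ hK hxK hKπ
  have c2 := fiber_cut hsys hG hσ hM hxM hMσ
  rw [← hsame] at c1
  have hF : {z | Function.update x i z ∈ polyUnion G} = Set.univ := by
    by_contra hun
    have he : π = σ := indep_eq (hsys.2.2.2.2 i π hπ σ hσ) _
      ⟨x i, by simpa using hxG⟩ hun c1 c2
    apply hun
    rw [Set.eq_univ_iff_forall]
    intro z
    obtain ⟨L, hL, hzL⟩ := mem_polyUnion'.1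
      (hcyl x (mem_polyUnion'.2 ⟨M, ⟨hM, he ▸ hMσ⟩, hxM⟩) z)
    exact mem_polyUnion'.2 ⟨L, hL.1, hzL⟩
  have hy : Function.update x i y ∈ polyUnion G := Set.eq_univ_iff_forall.1 hF y
  rw [hsame] at hy
  obtain ⟨L, hL, hyL⟩ := mem_polyUnion'.1 hy
  exact mem_polyUnion'.2 ⟨L, ⟨hL, fiber_part hsys hG' hπ hK hxK hKπ hL y hyL⟩, hyL⟩
end

section
/- Let (X, Π, 𝓑) be a system of d-boxes and let 𝓖 ⊆ 𝓑 be a finite Keller family. Then c(𝓖) ≤ |𝓖| − 1. -/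
open Set

/-- `C i (𝓖)`: the set of partitions in `P i` hidden in `𝓖`. -/
def hiddenSet {d : ℕ} {X : Fin d → Type*} (P : ∀ i, Set (Set (Set (X i))))
    (G : Set (∀ i, Set (X i))) (i : Fin d) : Set (Set (Set (X i))) :=
  {π | HiddenIn P G i π}

/-- `c_i(𝓖) = Σ_{π ∈ C_i(𝓖)} (|π| - 1)`. -/
noncomputable def cIdx {d : ℕ} {X : Fin d → Type*} (P : ∀ i, Set (Set (Set (X i))))
    (G : Set (∀ i, Set (X i))) (i : Fin d) : ℕ :=
  ∑ᶠ π ∈ hiddenSet P G i, (π.ncard - 1)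

/-- `c(𝓖) = Σ_i c_i(𝓖)`. -/
noncomputable def cTotal {d : ℕ} {X : Fin d → Type*} (P : ∀ i, Set (Set (Set (X i))))
    (G : Set (∀ i, Set (X i))) : ℕ :=
  ∑ i, cIdx P G i

theorem sat_unique {α : Type*} {π π' : Set (Set α)} (h1 : IsPartition π) (h2 : IsPartition π')
    (hind : π ≠ π' → IndepPartitions π π') (S : Set α) (hne : S.Nonempty) (hpr : S ≠ Set.univ)
    (s1 : ∀ b ∈ S, ∃ B ∈ π, b ∈ B ∧ B ⊆ S) (s2 : ∀ b ∈ S, ∃ B ∈ π', b ∈ B ∧ B ⊆ S) :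
    π = π' := by
  by_contra hn
  have key : ∀ σ : Set (Set α), IsPartition σ → (∀ b ∈ S, ∃ B ∈ σ, b ∈ B ∧ B ⊆ S) →
      Coarser σ {S, Sᶜ} := by
    intro σ hσ hs A hA
    by_cases h : (A ∩ S).Nonempty
    · obtain ⟨b, hbA, hbS⟩ := h
      obtain ⟨B, hB, hbB, hBS⟩ := hs b hbS
      have : A = B := hσ.2.1.elim hA hB (Set.not_disjoint_iff.2 ⟨b, hbA, hbB⟩)
      exact ⟨S, by simp, this ▸ hBS⟩
    · refine ⟨Sᶜ, by simp, ?_⟩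
      intro b hb hbS
      exact h ⟨b, hb, hbS⟩
  have hp : IsPartition ({S, Sᶜ} : Set (Set α)) := by
    refine ⟨?_, ?_, ?_⟩
    · rintro A (rfl | rfl)
      · exact hne
      · exact Set.nonempty_compl.2 hpr
    · rintro A (rfl | rfl) B (rfl | rfl) hAB
      · exact absurd rfl hAB
      · exact disjoint_compl_right
      · exact disjoint_compl_left
      · exact absurd rfl hAB
    · simp
  have := hind hn _ hp (key π h1 s1) (key π' h2 s2)
  have h3 : S ∈ ({Set.univ} : Set (Set α)) := by rw [← this]; simp
  exact hpr h3

theorem part_unique {α : Type*} {π π' : Set (Set α)} (h1 : IsPartition π) (h2 : IsPartition π')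
    (hind : π ≠ π' → IndepPartitions π π') (A : Set α) (hpr : A ≠ Set.univ)
    (s1 : A ∈ π) (s2 : A ∈ π') : π = π' :=
  sat_unique h1 h2 hind A (h1.1 A s1) hpr (fun b hb => ⟨A, s1, hb, subset_rfl⟩)
    (fun b hb => ⟨A, s2, hb, subset_rfl⟩)

theorem part_ne_univ {α : Type*} {π : Set (Set α)} (h1 : IsPartition π) (hn : π ≠ {Set.univ})
    (A : Set α) (hA : A ∈ π) : A ≠ Set.univ := by
  rintro rfl
  apply hn
  ext B
  constructor
  · intro hB
    obtain ⟨b, hb⟩ := h1.1 B hB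
    exact h1.2.1.elim hB hA (Set.not_disjoint_iff.2 ⟨b, hb, trivial⟩)
  · rintro rfl
    exact hA

section sums
variable {ι : Type*} [Fintype ι] [DecidableEq ι] {X : ι → Type*}

theorem sum_update (S : ∀ k, Finset (X k)) (i : ι) (F : (∀ k, X k) → ℝ) :
    ∑ x ∈ Fintype.piFinset S, ∑ a ∈ S i, F (Function.update x i a)
      = (S i).card * ∑ x ∈ Fintype.piFinset S, F x := by
  have h : ∑ p ∈ Fintype.piFinset S ×ˢ S i, F (Function.update p.1 i p.2)
      = ∑ p ∈ Fintype.piFinset S ×ˢ S i, F p.1 := by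
    have hmem : ∀ p ∈ Fintype.piFinset S ×ˢ S i,
        (Function.update p.1 i p.2, p.1 i) ∈ Fintype.piFinset S ×ˢ S i := by
      rintro ⟨x, a⟩ hp
      simp only [Finset.mem_product, Fintype.mem_piFinset] at hp ⊢
      refine ⟨fun k => ?_, hp.1 i⟩
      by_cases hk : k = i
      · subst hk; simpa using hp.2
      · simpa [hk] using hp.1 k
    refine Finset.sum_nbij' (fun p => (Function.update p.1 i p.2, p.1 i))
      (fun p => (Function.update p.1 i p.2, p.1 i)) hmem hmem ?_ ?_ ?_
    · rintro ⟨x, a⟩ _; simp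
    · rintro ⟨x, a⟩ _; simp
    · rintro ⟨x, a⟩ _; simp
  rw [Finset.sum_product, Finset.sum_product] at h
  rw [h]
  simp [Finset.mul_sum]

theorem sum_line_zero (S : ∀ k, Finset (X k)) (i : ι) (hS : (S i).Nonempty)
    (F : (∀ k, X k) → ℝ)
    (h : ∀ x, ∑ a ∈ S i, F (Function.update x i a) = 0) :
    ∑ x ∈ Fintype.piFinset S, F x = 0 := by
  have h1 := sum_update S i F
  simp only [h, Finset.sum_const_zero] at h1
  have : ((S i).card : ℝ) ≠ 0 := by exact_mod_cast hS.card_pos.ne'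
  rcases mul_eq_zero.1 h1.symm with h2 | h2
  · exact absurd h2 this
  · exact h2

theorem sum_plane_zero (S : ∀ k, Finset (X k)) (i j : ι) (hi : (S i).Nonempty)
    (hj : (S j).Nonempty) (F : (∀ k, X k) → ℝ)
    (h : ∀ x, ∑ a ∈ S i, ∑ b ∈ S j, F (Function.update (Function.update x i a) j b) = 0) :
    ∑ x ∈ Fintype.piFinset S, F x = 0 := by
  have h1 := sum_line_zero S i hi (fun x => ∑ b ∈ S j, F (Function.update x j b)) h
  rw [sum_update] at h1
  have : ((S j).card : ℝ) ≠ 0 := by exact_mod_cast hj.card_pos.ne'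
  rcases mul_eq_zero.1 h1 with h2 | h2
  · exact absurd h2 this
  · exact h2

end sums

section keller
variable {d : ℕ} {X : Fin d → Type*} {P : ∀ i, Set (Set (Set (X i)))}
  {G : Set (∀ i, Set (X i))}

theorem keller_eq (hsys : IsBoxSystem X P) (hG : IsKellerFamily P G) {K L : ∀ i, Set (X i)}
    (hK : K ∈ G) (hL : L ∈ G) (x : ∀ i, X i) (hxK : ∀ i, x i ∈ K i) (hxL : ∀ i, x i ∈ L i) :
    K = L := by
  by_contra hne
  obtain ⟨k, π, hπ, h1, h2, h3⟩ := hG.2.2 K hK L hL hne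
  exact h3 ((hsys.2.2.2.1 k π hπ).2.1.elim h1 h2 (Set.not_disjoint_iff.2 ⟨x k, hxK k, hxL k⟩))

theorem mem_poly {F : Set (∀ i, Set (X i))} {x : ∀ i, X i} :
    x ∈ polyUnion F ↔ ∃ K ∈ F, ∀ i, x i ∈ K i := by
  simp [polyUnion, boxSet]

theorem mem_cyl {i : Fin d} {π : Set (Set (X i))} {x : ∀ i, X i} :
    x ∈ polyUnion (restrictFam G i π) ↔ ∃ K ∈ G, K i ∈ π ∧ ∀ i, x i ∈ K i := by
  simp [mem_poly, restrictFam, and_assoc]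

theorem cyl_iff {i : Fin d} {W : Set (∀ j, X j)} (h : IsCylinder i W) (x : ∀ j, X j) (a : X i) :
    Function.update x i a ∈ W ↔ x ∈ W := by
  refine ⟨fun hx => ?_, fun hx => h x hx a⟩
  have := h _ hx (x i)
  simpa using this

theorem plane_key (hsys : IsBoxSystem X P) (hG : IsKellerFamily P G) {i j : Fin d} (hij : i ≠ j)
    {π : Set (Set (X i))} {ρ : Set (Set (X j))} (hπ : HiddenIn P G i π) (hρ : HiddenIn P G j ρ)
    (x : ∀ k, X k)
    (hV : ∃ a, Function.update x i a ∈ polyUnion (restrictFam G j ρ))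
    (hW : ∃ b, Function.update x j b ∈ polyUnion (restrictFam G i π)) :
    (∀ a, Function.update x i a ∈ polyUnion (restrictFam G j ρ)) ∨
    (∀ b, Function.update x j b ∈ polyUnion (restrictFam G i π)) := by
  by_contra hcon
  push Not at hcon
  obtain ⟨⟨a1, ha1⟩, ⟨b1, hb1⟩⟩ := hcon
  obtain ⟨a0, ha0⟩ := hV
  set W := polyUnion (restrictFam G i π) with hWdef
  set V := polyUnion (restrictFam G j ρ) with hVdef
  let pt : X i → X j → ∀ k, X k := fun a b => Function.update (Function.update x i a) j b
  have hpti : ∀ a b, pt a b i = a := by intro a b; simp [pt, hij]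
  have hptj : ∀ a b, pt a b j = b := by intro a b; simp [pt]
  have hptk : ∀ a b k, k ≠ i → k ≠ j → pt a b k = x k := by
    intro a b k hi hj; simp [pt, hi, hj]
  have hptV : ∀ a b, pt a b ∈ V ↔ Function.update x i a ∈ V := fun a b =>
    cyl_iff hρ.2.2.2 _ b
  have hptW : ∀ a b, pt a b ∈ W ↔ Function.update x j b ∈ W := fun a b => by
    simp only [pt]
    rw [Function.update_comm hij]
    exact cyl_iff hπ.2.2.2 _ a
  let W0 : Set (X j) := {b | Function.update x j b ∈ W}
  have hpr : W0 ≠ Set.univ := fun h => hb1 (by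
    have : b1 ∈ W0 := h ▸ Set.mem_univ b1
    exact this)
  -- boxes through points over `W0` stay inside `W0`
  have hsub : ∀ a b K, K ∈ G → K i ∈ π → (∀ k, pt a b k ∈ K k) → K j ⊆ W0 := by
    intro a b K hK hKi hKx b' hb'
    refine (hptW a b').1 (mem_cyl.2 ⟨K, hK, hKi, fun k => ?_⟩)
    by_cases hkj : k = j
    · subst hkj; rw [hptj]; exact hb'
    · have := hKx k
      have h2 : pt a b' k = pt a b k := by simp [pt, hkj]
      rw [h2]; exact this
  have hρP := hsys.2.2.2.1 j ρ hρ.1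
  have s1 : ∀ b ∈ W0, ∃ B ∈ ρ, b ∈ B ∧ B ⊆ W0 := by
    intro b hb
    obtain ⟨K, hK, hKi, hKx⟩ := mem_cyl.1 ((hptW a0 b).2 hb)
    obtain ⟨L, hL, hLj, hLx⟩ := mem_cyl.1 ((hptV a0 b).2 ha0)
    have := keller_eq hsys hG hK hL _ hKx hLx
    subst this
    refine ⟨K j, hLj, ?_, hsub a0 b K hK hKi hKx⟩
    have := hKx j
    rwa [hptj] at this
  have s2 : ∀ b ∈ W0, ∃ K ∈ G, K i ∈ π ∧ K j ∉ ρ ∧ (∀ k, pt a1 b k ∈ K k) ∧ K j ⊆ W0 := by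
    intro b hb
    obtain ⟨K, hK, hKi, hKx⟩ := mem_cyl.1 ((hptW a1 b).2 hb)
    refine ⟨K, hK, hKi, fun hKj => ?_, hKx, hsub a1 b K hK hKi hKx⟩
    exact ha1 ((hptV a1 b).1 (mem_cyl.2 ⟨K, hK, hKj, hKx⟩))
  obtain ⟨b0, hb0⟩ := hW
  obtain ⟨K, hK, hKi, hKj, hKx, hKs⟩ := s2 b0 hb0
  obtain ⟨ρ', hρ', hKρ'⟩ := hG.2.1 K hK j
  have hρ'P := hsys.2.2.2.1 j ρ' hρ'
  have hKu : K j ≠ Set.univ := fun h => hpr (Set.univ_subset_iff.1 (h ▸ hKs))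
  have s3 : ∀ b ∈ W0, ∃ B ∈ ρ', b ∈ B ∧ B ⊆ W0 := by
    intro b hb
    obtain ⟨L, hL, hLi, hLj, hLx, hLs⟩ := s2 b hb
    refine ⟨L j, ?_, ?_, hLs⟩
    · by_cases hKL : K = L
      · exact hKL ▸ hKρ'
      obtain ⟨k, σ, hσ, h1, h2, h3⟩ := hG.2.2 K hK L hL hKL
      have hσP := hsys.2.2.2.1 k σ hσ
      have hkj : k = j := by
        by_contra hkj
        have h4 : pt a1 b0 k = pt a1 b k := by simp [pt, hkj]
        apply h3
        refine hσP.2.1.elim h1 h2 (Set.not_disjoint_iff.2 ⟨_, hKx k, ?_⟩)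
        rw [h4]; exact hLx k
      subst hkj
      have : σ = ρ' := part_unique hσP hρ'P (hsys.2.2.2.2 k σ hσ ρ' hρ') (K k) hKu h1 hKρ'
      exact this ▸ h2
    · have := hLx j
      rwa [hptj] at this
  have := sat_unique hρP hρ'P (hsys.2.2.2.2 j ρ hρ.1 ρ' hρ') W0 ⟨b0, hb0⟩ hpr s1 s3
  exact hKj (this ▸ hKρ')

theorem hidden_part (hsys : IsBoxSystem X P) (hG : IsKellerFamily P G) {i : Fin d}
    {π : Set (Set (X i))} (hπ : HiddenIn P G i π) {A : Set (X i)} (hA : A ∈ π) :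
    ∃ K ∈ G, K i = A := by
  obtain ⟨K, hK, hKi⟩ := hπ.2.2.1.1
  have hne : ∀ k, (K k).Nonempty := fun k => by
    obtain ⟨σ, hσ, h⟩ := hG.2.1 K hK k
    exact (hsys.2.2.2.1 k σ hσ).1 _ h
  choose x hx using hne
  obtain ⟨a, ha⟩ := (hsys.2.2.2.1 i π hπ.1).1 A hA
  obtain ⟨L, hL, hLi, hLx⟩ := mem_cyl.1 (hπ.2.2.2 x (mem_cyl.2 ⟨K, hK, hKi, hx⟩) a)
  refine ⟨L, hL, ?_⟩
  have := hLx i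
  rw [Function.update_self] at this
  exact (hsys.2.2.2.1 i π hπ.1).2.1.elim hLi hA (Set.not_disjoint_iff.2 ⟨a, this, ha⟩)

open Classical in
/-- The function equal to `s (x i)` on the polybox of `G|π` and zero elsewhere. -/
noncomputable def gfun (G : Set (∀ i, Set (X i))) (i : Fin d) (π : Set (Set (X i)))
    (s : X i → ℝ) (x : ∀ k, X k) : ℝ :=
  if x ∈ polyUnion (restrictFam G i π) then s (x i) else 0

theorem gfun_line (S : ∀ k, Finset (X k)) {i : Fin d} (hi : (S i).Nonempty)
    {π : Set (Set (X i))} (hπ : HiddenIn P G i π) (s : X i → ℝ) (hs : ∑ y ∈ S i, s y = 0) :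
    ∑ x ∈ Fintype.piFinset S, gfun G i π s x = 0 := by
  refine sum_line_zero S i hi _ fun x => ?_
  have h1 := cyl_iff hπ.2.2.2 x
  by_cases hx : x ∈ polyUnion (restrictFam G i π)
  · have h2 : ∀ a, Function.update x i a ∈ polyUnion (restrictFam G i π) := fun a => (h1 a).2 hx
    simp [gfun, h2, hs]
  · have h2 : ∀ a, Function.update x i a ∉ polyUnion (restrictFam G i π) :=
      fun a h => hx ((h1 a).1 h)
    simp [gfun, h2]

theorem gfun_orth_ne (hsys : IsBoxSystem X P) (hG : IsKellerFamily P G)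
    (S : ∀ k, Finset (X k)) {i j : Fin d} (hij : i ≠ j) (hi : (S i).Nonempty)
    (hj : (S j).Nonempty)
    {π : Set (Set (X i))} {ρ : Set (Set (X j))} (hπ : HiddenIn P G i π) (hρ : HiddenIn P G j ρ)
    (s : X i → ℝ) (hs : ∑ y ∈ S i, s y = 0) (t : X j → ℝ) (ht : ∑ y ∈ S j, t y = 0) :
    ∑ x ∈ Fintype.piFinset S, gfun G i π s x * gfun G j ρ t x = 0 := by
  classical
  refine sum_plane_zero S i j hi hj _ fun x => ?_
  have e : ∀ a b, gfun G i π s (Function.update (Function.update x i a) j b) *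
      gfun G j ρ t (Function.update (Function.update x i a) j b) =
      (if Function.update x i a ∈ polyUnion (restrictFam G j ρ) then s a else 0) *
      (if Function.update x j b ∈ polyUnion (restrictFam G i π) then t b else 0) := by
    intro a b
    have h1 : Function.update (Function.update x i a) j b ∈ polyUnion (restrictFam G i π) ↔
        Function.update x j b ∈ polyUnion (restrictFam G i π) := by
      rw [Function.update_comm hij]
      exact cyl_iff hπ.2.2.2 _ a
    have h2 := cyl_iff hρ.2.2.2 (Function.update x i a) b
    simp only [gfun, h1, h2]
    simp only [Function.update_self, Function.update_of_ne hij]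
    split_ifs <;> simp
  simp only [e]
  rw [← Finset.sum_mul_sum]
  by_cases hV : ∃ a, Function.update x i a ∈ polyUnion (restrictFam G j ρ)
  · by_cases hW : ∃ b, Function.update x j b ∈ polyUnion (restrictFam G i π)
    · rcases plane_key hsys hG hij hπ hρ x hV hW with h | h
      · simp [h, hs]
      · simp [h, ht]
    · push Not at hW
      simp [hW]
  · push Not at hV
    simp [hV]

theorem gfun_orth_eq (hsys : IsBoxSystem X P) (hG : IsKellerFamily P G)
    {i : Fin d} {π ρ : Set (Set (X i))} (hπ : HiddenIn P G i π) (hρ : HiddenIn P G i ρ)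
    (hne : π ≠ ρ) (s t : X i → ℝ) (x : ∀ k, X k) : gfun G i π s x * gfun G i ρ t x = 0 := by
  classical
  simp only [gfun]
  split_ifs with h1 h2
  · obtain ⟨K, hK, hKi, hKx⟩ := mem_cyl.1 h1
    obtain ⟨L, hL, hLj, hLx⟩ := mem_cyl.1 h2
    have := keller_eq hsys hG hK hL _ hKx hLx
    subst this
    have hP := hsys.2.2.2.1 i π hπ.1
    exact absurd (part_unique hP (hsys.2.2.2.1 i ρ hρ.1) (hsys.2.2.2.2 i π hπ.1 ρ hρ.1) (K i)
      (part_ne_univ hP hπ.2.1 _ hKi) hKi hLj) hne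
  all_goals simp

end keller

theorem stmt_5 {d : ℕ} {X : Fin d → Type*} (P : ∀ i, Set (Set (Set (X i))))
    (hsys : IsBoxSystem X P)
    (G : Set (∀ i, Set (X i))) (hG : IsKellerFamily P G) (hfin : G.Finite) :
    cTotal P G ≤ G.ncard - 1 := by
  classical
  have hPfin : ∀ i, (hiddenSet P G i).Finite := fun i =>
    (hsys.2.1 i).subset fun π hπ => hπ.1
  let C := Σ i, hiddenSet P G i
  have : ∀ i, Fintype (hiddenSet P G i) := fun i => (hPfin i).fintype
  have hfp : ∀ p : C, Fintype (p.2.1 : Set (Set (X p.1))) := fun p =>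
    (hsys.2.2.1 p.1 p.2.1 p.2.2.1).fintype
  have : Fintype G := hfin.fintype
  -- sample points
  have hpt : ∀ K : G, ∃ x : ∀ k, X k, ∀ k, x k ∈ K.1 k := fun K => by
    have hne : ∀ k, (K.1 k).Nonempty := fun k => by
      obtain ⟨σ, hσ, h⟩ := hG.2.1 K.1 K.2 k
      exact (hsys.2.2.2.1 k σ hσ).1 _ h
    choose x hx using hne
    exact ⟨x, hx⟩
  choose z hz using hpt
  let S : ∀ k, Finset (X k) := fun k => Finset.univ.image fun K : G => z K k
  have hzS : ∀ K, z K ∈ Fintype.piFinset S := fun K => by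
    simp [S, Fintype.mem_piFinset]
  obtain ⟨K0, hK0⟩ := hG.1
  have hSne : ∀ k, (S k).Nonempty := fun k =>
    ⟨z ⟨K0, hK0⟩ k, (Fintype.mem_piFinset.1 (hzS ⟨K0, hK0⟩)) k⟩
  let V := (Σ p : C, (p.2.1 : Set (Set (X p.1)))) → ℝ
  let s : V → ∀ p : C, X p.1 → ℝ := fun t p y =>
    ∑ A : (p.2.1 : Set (Set (X p.1))), if y ∈ A.1 then t ⟨p, A⟩ else 0
  have hs_add : ∀ t t' p y, s (t + t') p y = s t p y + s t' p y := by
    intro t t' p y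
    simp only [s, ← Finset.sum_add_distrib]
    refine Finset.sum_congr rfl fun A _ => ?_
    split_ifs
    · rfl
    · simp
  have hs_smul : ∀ (r : ℝ) t p y, s (r • t) p y = r * s t p y := by
    intro r t p y
    simp only [s, Finset.mul_sum]
    refine Finset.sum_congr rfl fun A _ => ?_
    split_ifs
    · rfl
    · simp
  have hs_part : ∀ t (p : C) (A : (p.2.1 : Set (Set (X p.1)))) y, y ∈ A.1 →
      s t p y = t ⟨p, A⟩ := by
    intro t p A y hy
    simp only [s]
    rw [Finset.sum_eq_single A]
    · simp [hy]
    · intro B _ hBA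
      rw [if_neg]
      intro hyB
      exact hBA (Subtype.ext ((hsys.2.2.2.1 p.1 p.2.1 p.2.2.1).2.1.elim B.2 A.2
        (Set.not_disjoint_iff.2 ⟨y, hyB, hy⟩)))
    · simp
  let g : V → C → (∀ k, X k) → ℝ := fun t p x => gfun G p.1 p.2.1 (s t p) x
  have hg_const : ∀ t p (K : G) x y, (∀ k, x k ∈ K.1 k) → (∀ k, y k ∈ K.1 k) →
      g t p x = g t p y := by
    intro t p K
    have hiff : ∀ x, (∀ k, x k ∈ K.1 k) →
        (x ∈ polyUnion (restrictFam G p.1 p.2.1) ↔ K.1 p.1 ∈ p.2.1) := by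
      intro x hx
      refine ⟨fun h => ?_, fun h => mem_cyl.2 ⟨K.1, K.2, h, hx⟩⟩
      obtain ⟨L, hL, hLi, hLx⟩ := mem_cyl.1 h
      rw [keller_eq hsys hG K.2 hL x hx hLx]
      exact hLi
    intro x y hx hy
    simp only [g, gfun, hiff x hx, hiff y hy]
    split_ifs with h
    · rw [hs_part t p ⟨_, h⟩ _ (hx p.1), hs_part t p ⟨_, h⟩ _ (hy p.1)]
    · rfl
  let Φ : (ℝ × V) →ₗ[ℝ] (G → ℝ) × (C → ℝ) :=
    { toFun := fun v => (fun K => v.1 + ∑ p, g v.2 p (z K), fun p => ∑ y ∈ S p.1, s v.2 p y)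
      map_add' := by
        rintro ⟨c, t⟩ ⟨c', t'⟩
        have : ∀ p x, g (t + t') p x = g t p x + g t' p x := by
          intro p x
          simp only [g, gfun, hs_add]
          split_ifs <;> simp
        ext K
        · simp only [Prod.mk_add_mk, this, Finset.sum_add_distrib, Pi.add_apply]
          ring
        · simp only [Prod.mk_add_mk, hs_add, Finset.sum_add_distrib, Pi.add_apply]
      map_smul' := by
        rintro r ⟨c, t⟩
        have : ∀ p x, g (r • t) p x = r * g t p x := by
          intro p x
          simp only [g, gfun, hs_smul]
          split_ifs <;> simp
        ext K
        · simp only [Prod.smul_mk, this, ← Finset.mul_sum, Pi.smul_apply, smul_eq_mul,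
            RingHom.id_apply]
          ring
        · simp only [Prod.smul_mk, hs_smul, ← Finset.mul_sum, Pi.smul_apply, smul_eq_mul,
            RingHom.id_apply] }
  have hinj : Function.Injective Φ := by
    rw [injective_iff_map_eq_zero]
    rintro ⟨c, t⟩ h0
    have hF : ∀ K : G, c + ∑ p, g t p (z K) = 0 := fun K => congrFun (congrArg Prod.fst h0) K
    have hm : ∀ p : C, ∑ y ∈ S p.1, s t p y = 0 := fun p => congrFun (congrArg Prod.snd h0) p
    have hmul : ∀ q x, c * g t q x + ∑ p, g t p x * g t q x = 0 := by
      intro q x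
      by_cases hx : x ∈ polyUnion (restrictFam G q.1 q.2.1)
      · obtain ⟨K, hK, -, hKx⟩ := mem_cyl.1 hx
        have h1 := hF ⟨K, hK⟩
        rw [Finset.sum_congr rfl fun p _ => hg_const t p ⟨K, hK⟩ _ x (hz ⟨K, hK⟩) hKx] at h1
        rw [← Finset.sum_mul, ← add_mul, h1, zero_mul]
      · have : g t q x = 0 := by simp [g, gfun, hx]
        simp [this]
    have hsq : ∀ q, ∑ x ∈ Fintype.piFinset S, g t q x * g t q x = 0 := by
      intro q
      have h1 : ∑ x ∈ Fintype.piFinset S, (c * g t q x + ∑ p, g t p x * g t q x) = 0 :=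
        Finset.sum_eq_zero fun x _ => hmul q x
      rw [Finset.sum_add_distrib, ← Finset.mul_sum,
        gfun_line S (hSne q.1) q.2.2 (s t q) (hm q), mul_zero, zero_add, Finset.sum_comm,
        Finset.sum_eq_single q] at h1
      · exact h1
      · intro p _ hpq
        by_cases hi : p.1 = q.1
        · obtain ⟨i, π⟩ := p
          obtain ⟨j, ρ⟩ := q
          obtain rfl : i = j := hi
          refine Finset.sum_eq_zero fun x _ => ?_
          refine gfun_orth_eq hsys hG π.2 ρ.2 (fun h => hpq ?_) _ _ x
          rw [Subtype.ext h]
        · exact gfun_orth_ne hsys hG S hi (hSne _) (hSne _) p.2.2 q.2.2 _ (hm p) _ (hm q)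
      · simp
    have hg0 : ∀ q, ∀ x ∈ Fintype.piFinset S, g t q x = 0 := by
      intro q x hx
      have := (Finset.sum_eq_zero_iff_of_nonneg fun x _ => mul_self_nonneg (g t q x)).1 (hsq q) x hx
      exact mul_self_eq_zero.1 this
    have ht : t = 0 := by
      ext ⟨q, A⟩
      obtain ⟨K, hK, hKA⟩ := hidden_part hsys hG q.2.2 A.2
      have h1 := hg0 q _ (hzS ⟨K, hK⟩)
      have hmem : z ⟨K, hK⟩ ∈ polyUnion (restrictFam G q.1 q.2.1) :=
        mem_cyl.2 ⟨K, hK, hKA ▸ A.2, hz ⟨K, hK⟩⟩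
      simp only [g, gfun, if_pos hmem] at h1
      rw [hs_part t q A _ (by rw [← hKA]; exact hz ⟨K, hK⟩ q.1)] at h1
      exact h1
    have hc : c = 0 := by
      have h1 := hF ⟨K0, hK0⟩
      rwa [Finset.sum_eq_zero fun p _ => hg0 p _ (hzS _), add_zero] at h1
    rw [ht, hc]; rfl
  have hdim := LinearMap.finrank_le_finrank_of_injective hinj
  simp only [V, Module.finrank_prod, Module.finrank_self, Module.finrank_fintype_fun_eq_card,
    Fintype.card_sigma (α := fun p : C => (p.2.1 : Set (Set (X p.1))))] at hdim
  have hcT : cTotal P G = ∑ p : C, (Fintype.card (p.2.1 : Set (Set (X p.1))) - 1) := by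
    rw [cTotal, Fintype.sum_sigma]
    refine Finset.sum_congr rfl fun i _ => ?_
    rw [cIdx, ← finsum_set_coe_eq_finsum_mem, finsum_eq_sum_of_fintype]
    refine Finset.sum_congr rfl fun π _ => ?_
    rw [← Nat.card_coe_set_eq, @Nat.card_eq_fintype_card _ (hfp ⟨i, π⟩)]
  have hGn : G.ncard = Fintype.card G := by rw [← Nat.card_coe_set_eq, Nat.card_eq_fintype_card]
  have hpos : ∀ p : C, 1 ≤ Fintype.card (p.2.1 : Set (Set (X p.1))) := by
    intro p
    obtain ⟨K, hK⟩ := p.2.2.2.2.1.1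
    exact Fintype.card_pos_iff.2 ⟨⟨K p.1, hK.2⟩⟩
  have hsum : ∑ p : C, Fintype.card (p.2.1 : Set (Set (X p.1))) =
      ∑ p : C, (Fintype.card (p.2.1 : Set (Set (X p.1))) - 1) + Fintype.card C := by
    rw [← Finset.card_univ, Finset.card_eq_sum_ones, ← Finset.sum_add_distrib]
    exact Finset.sum_congr rfl fun p _ => (Nat.sub_add_cancel (hpos p)).symm
  rw [hcT, hGn]
  omega
end

section
/- Let n ≥ 2 be an integer, let m = (n, n, …, n) ∈ ℤ^d, and let [0,1)^d ⊕ T be a cube tiling of the torus T^d_m. Then Σ_{i=1}^d |p_i(T)| ≤ (n^d − 1)/(n − 1). -/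
open Set

/-- `amod r m` is the representative of `r` modulo `m` in `[0, m)`. -/
noncomputable def amod (r : ℝ) (m : ℕ) : ℝ := r - (m : ℝ) * (⌊r / (m : ℝ)⌋ : ℝ)

/-- The torus `T^d_m = [0,m_1) × ⋯ × [0,m_d)`. -/
def torus {d : ℕ} (m : Fin d → ℕ) : Set (Fin d → ℝ) :=
  {x | ∀ i, x i ∈ Set.Ico (0 : ℝ) (m i)}

/-- The translated unit cube `[0,1)^d ⊕ t` inside the torus. -/
def cube {d : ℕ} (m : Fin d → ℕ) (t : Fin d → ℝ) : Set (Fin d → ℝ) :=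
  {x ∈ torus m | ∀ i, amod (x i - t i) (m i) < 1}

/-- `[0,1)^d ⊕ T` is a cube tiling of the torus: a partition of `T^d_m` into translated
unit cubes. -/
def IsCubeTiling {d : ℕ} (m : Fin d → ℕ) (T : Set (Fin d → ℝ)) : Prop :=
  T ⊆ torus m ∧ (∀ s ∈ T, ∀ t ∈ T, s ≠ t → Disjoint (cube m s) (cube m t)) ∧
    ⋃ t ∈ T, cube m t = torus m

/-- `p_i(T) = {t_i mod 1 : t ∈ T}`. -/
def pset {d : ℕ} (T : Set (Fin d → ℝ)) (i : Fin d) : Set ℝ :=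
  (fun t => Int.fract (t i)) '' T

lemma amod_lt_one_iff (n : ℕ) (hn : 2 ≤ n) (r : ℝ) : amod r n < 1 ↔ (n : ℤ) ∣ ⌊r⌋ := by
  have hn0 : (0 : ℝ) < n := by positivity
  unfold amod
  constructor
  · intro h
    refine ⟨⌊r / n⌋, ?_⟩
    rw [Int.floor_eq_iff]
    have h1 := Int.floor_le (r / n)
    rw [le_div_iff₀ hn0] at h1
    push_cast
    constructor <;> nlinarith
  · rintro ⟨m, hm⟩
    have h1 := Int.floor_le r
    have h2 := Int.lt_floor_add_one r
    have h3 : ⌊r / n⌋ = m := by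
      rw [Int.floor_eq_iff, le_div_iff₀ hn0, div_lt_iff₀ hn0]
      have hn2 : (2 : ℝ) ≤ n := by exact_mod_cast hn
      rw [hm] at h1 h2
      push_cast at h1 h2
      constructor <;> nlinarith
    rw [h3]
    rw [hm] at h2
    push_cast at h2
    linarith

lemma amod_mem (n : ℕ) (hn : 2 ≤ n) (r : ℝ) : amod r n ∈ Set.Ico (0 : ℝ) n := by
  have hn0 : (0 : ℝ) < n := by positivity
  unfold amod
  have h1 := Int.floor_le (r / n)
  have h2 := Int.lt_floor_add_one (r / n)
  rw [le_div_iff₀ hn0] at h1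
  rw [div_lt_iff₀ hn0] at h2
  constructor <;> nlinarith

lemma dvd_floor_shift (n : ℕ) (a b : ℝ) (m : ℤ) (h : a = b + n * m) (hb : (n : ℤ) ∣ ⌊b⌋) :
    (n : ℤ) ∣ ⌊a⌋ := by
  have : ⌊a⌋ = ⌊b⌋ + n * m := by
    rw [h]
    have : (b + n * m : ℝ) = b + ((n * m : ℤ) : ℝ) := by push_cast; ring
    rw [this, Int.floor_add_intCast]
  rw [this]
  exact dvd_add hb (dvd_mul_right _ _)

/-- Abstract form of a tiling: `τ x` is the corner of the cube that contains `x`. -/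
structure TauLaw {d : ℕ} (n : ℕ) (τ : (Fin d → ℝ) → (Fin d → ℝ)) : Prop where
  mem : ∀ x i, (n : ℤ) ∣ ⌊x i - τ x i⌋
  uniq : ∀ x y, (∀ i, (n : ℤ) ∣ ⌊x i - τ y i⌋) → τ x = τ y

lemma exists_tau {d : ℕ} (n : ℕ) (hn : 2 ≤ n) (T : Set (Fin d → ℝ))
    (hT : IsCubeTiling (fun _ : Fin d => n) T) :
    ∃ τ : (Fin d → ℝ) → (Fin d → ℝ), TauLaw n τ ∧ T = Set.range τ := by
  obtain ⟨hsub, hdis, hcov⟩ := hT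
  have key : ∀ x : Fin d → ℝ, ∃ y : Fin d → ℝ, y ∈ torus (fun _ : Fin d => n) ∧
      ∀ i, ∃ m : ℤ, y i = x i + n * m := by
    intro x
    refine ⟨fun i => amod (x i) n, fun i => amod_mem n hn _, fun i => ⟨-⌊x i / n⌋, ?_⟩⟩
    simp only [amod]; push_cast; ring
  have hex : ∀ x : Fin d → ℝ, ∃ t ∈ T, ∀ i, (n : ℤ) ∣ ⌊x i - t i⌋ := by
    intro x
    obtain ⟨y, hy, hxy⟩ := key x
    rw [← hcov] at hy
    simp only [Set.mem_iUnion] at hy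
    obtain ⟨t, ht, hyt⟩ := hy
    refine ⟨t, ht, fun i => ?_⟩
    obtain ⟨m, hm⟩ := hxy i
    have := (amod_lt_one_iff n hn _).1 (hyt.2 i)
    exact dvd_floor_shift n _ (y i - t i) (-m) (by rw [hm]; push_cast; ring) this
  have hun : ∀ x : Fin d → ℝ, ∀ s ∈ T, ∀ t ∈ T, (∀ i, (n : ℤ) ∣ ⌊x i - s i⌋) →
      (∀ i, (n : ℤ) ∣ ⌊x i - t i⌋) → s = t := by
    intro x s hs t ht h1 h2
    by_contra hne
    obtain ⟨y, hy, hxy⟩ := key x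
    have := hdis s hs t ht hne
    rw [Set.disjoint_left] at this
    refine this (a := y) ⟨hy, fun i => (amod_lt_one_iff n hn _).2 ?_⟩
      ⟨hy, fun i => (amod_lt_one_iff n hn _).2 ?_⟩
    · obtain ⟨m, hm⟩ := hxy i
      exact dvd_floor_shift n _ (x i - s i) m (by rw [hm]; ring) (h1 i)
    · obtain ⟨m, hm⟩ := hxy i
      exact dvd_floor_shift n _ (x i - t i) m (by rw [hm]; ring) (h2 i)
  choose τ hτ1 hτ2 using hex
  refine ⟨τ, ⟨hτ2, fun x y h => hun x _ (hτ1 x) _ (hτ1 y) (hτ2 x) h⟩, ?_⟩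
  ext t
  constructor
  · intro ht
    exact ⟨t, hun t _ (hτ1 t) _ ht (hτ2 t) (fun i => by simp)⟩
  · rintro ⟨x, rfl⟩
    exact hτ1 x

section
variable {d n : ℕ} {τ : (Fin d → ℝ) → (Fin d → ℝ)}

lemma TauLaw.step (h : TauLaw n τ) (hn : 2 ≤ n) (x : Fin d → ℝ) (i : Fin d) :
    ∃ m : ℤ, τ (Function.update x i (x i + 1)) i = τ x i + 1 + n * m := by
  set t := τ x with ht
  set y := Function.update x i (t i + 1) with hy
  set s := τ y with hs
  have hyi := h.mem y i
  rw [← hs] at hyi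
  have hyi' : y i = t i + 1 := by simp [hy]
  rw [hyi'] at hyi
  set δ := Int.fract (t i + 1 - s i) with hδ
  have hfl : (⌊t i + 1 - s i⌋ : ℝ) = t i + 1 - s i - δ := by
    have := Int.floor_add_fract (t i + 1 - s i); linarith
  have hδ0 : 0 ≤ δ := Int.fract_nonneg _
  have hδ1 : δ < 1 := Int.fract_lt_one _
  have hzero : δ = 0 := by
    by_contra hne
    have hpos : 0 < δ := lt_of_le_of_ne hδ0 (Ne.symm hne)
    set w := Function.update x i (t i + 1 - δ) with hw
    have e1 : τ w = t := by
      apply h.uniq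
      intro j
      by_cases hj : j = i
      · subst hj
        have : ⌊w j - τ x j⌋ = 0 := by
          rw [Int.floor_eq_iff]
          simp only [hw, Function.update_self, ← ht]
          constructor <;> push_cast <;> linarith
        rw [this]; simp
      · simp only [hw, Function.update_of_ne hj]
        exact h.mem x j
    have e2 : τ w = s := by
      apply h.uniq
      intro j
      by_cases hj : j = i
      · subst hj
        have : w j - τ y j = (⌊t j + 1 - s j⌋ : ℝ) := by
          simp only [hw, Function.update_self, ← hs]
          linarith
        rw [this, Int.floor_intCast]
        exact hyi
      · have := h.mem y j
        simp only [hw, Function.update_of_ne hj]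
        rw [← hs] at this ⊢
        simpa only [hy, Function.update_of_ne hj] using this
    have e3 : s = t := e2.symm.trans e1
    rw [e3] at hyi
    have : ⌊t i + 1 - t i⌋ = 1 := by simp
    rw [this] at hyi
    have := Int.le_of_dvd one_pos hyi
    omega
  obtain ⟨m, hm⟩ := hyi
  rw [hm, hzero] at hfl
  push_cast at hfl
  have e : τ (Function.update x i (x i + 1)) = s := by
    apply h.uniq
    intro j
    by_cases hj : j = i
    · subst hj
      refine dvd_floor_shift n _ (x j - t j) m ?_ (h.mem x j)
      simp only [Function.update_self, ← hs]
      linarith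
    · have := h.mem y j
      simp only [Function.update_of_ne hj]
      rw [← hs] at this ⊢
      simpa only [hy, Function.update_of_ne hj] using this
  refine ⟨-m, ?_⟩
  rw [e]; push_cast; linarith

lemma TauLaw.stepNat (h : TauLaw n τ) (hn : 2 ≤ n) (x : Fin d → ℝ) (i : Fin d) (N : ℕ) :
    ∃ m : ℤ, τ (Function.update x i (x i + N)) i = τ x i + N + n * m := by
  induction N with
  | zero => exact ⟨0, by simp⟩
  | succ N ih =>
    obtain ⟨m, hm⟩ := ih
    obtain ⟨m', hm'⟩ := h.step hn (Function.update x i (x i + N)) i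
    refine ⟨m + m', ?_⟩
    rw [hm] at hm'
    simp only [Function.update_self, Function.update_idem] at hm'
    push_cast
    rw [← add_assoc, hm']
    ring

lemma TauLaw.stepInt (h : TauLaw n τ) (hn : 2 ≤ n) (x : Fin d → ℝ) (i : Fin d) (z : ℤ) :
    ∃ m : ℤ, τ (Function.update x i (x i + z)) i = τ x i + z + n * m := by
  obtain ⟨N, rfl | rfl⟩ := z.eq_nat_or_neg
  · simpa using h.stepNat hn x i N
  · obtain ⟨m, hm⟩ := h.stepNat hn (Function.update x i (x i + ((-(N : ℤ) : ℤ) : ℝ))) i N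
    simp only [Function.update_self, Function.update_idem] at hm
    have : x i + ((-(N : ℤ) : ℤ) : ℝ) + N = x i := by push_cast; ring
    rw [this, Function.update_eq_self] at hm
    refine ⟨-m, ?_⟩
    rw [hm]; push_cast; ring

lemma TauLaw.line (h : TauLaw n τ) (hn : 2 ≤ n) (x : Fin d → ℝ) (i : Fin d) (r : ℝ) :
    Int.fract (τ (Function.update x i r) i) = Int.fract (τ x i) := by
  set z : ℤ := ⌊r - τ x i⌋ - ⌊x i - τ x i⌋ with hz
  obtain ⟨m, hm⟩ := h.stepInt hn x i z
  set y := Function.update x i (x i + z) with hy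
  have e : τ (Function.update x i r) = τ y := by
    apply h.uniq
    intro j
    by_cases hj : j = i
    · subst hj
      have : r - τ y j = (r - τ x j) + ((-z - n * m : ℤ) : ℝ) := by
        rw [hm]; push_cast; ring
      simp only [Function.update_self]
      rw [this, Int.floor_add_intCast]
      have : ⌊r - τ x j⌋ + (-z - n * m) = ⌊x j - τ x j⌋ + n * (-m) := by rw [hz]; ring
      rw [this]
      exact dvd_add (h.mem x j) (dvd_mul_right _ _)
    · have := h.mem y j
      simp only [Function.update_of_ne hj]
      rw [hy, Function.update_of_ne hj, ← hy] at this
      exact this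
  rw [e, hm]
  have : τ x i + z + n * m = τ x i + ((z + n * m : ℤ) : ℝ) := by push_cast; ring
  rw [this, Int.fract_add_intCast]

lemma TauLaw.const (h : TauLaw n τ) (hn : 2 ≤ n) (x : Fin d → ℝ) (j : Fin d) (y y' : ℝ)
    (hy : ⌊y - Int.fract (τ x j)⌋ = ⌊y' - Int.fract (τ x j)⌋) :
    τ (Function.update x j y') = τ (Function.update x j y) := by
  apply h.uniq
  intro k
  by_cases hk : k = j
  · subst hk
    have h1 := h.mem (Function.update x k y) k
    have h2 := h.line hn x k y
    set s := τ (Function.update x k y) k with hs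
    rw [← h2] at hy
    have e : ∀ w : ℝ, ⌊w - s⌋ = ⌊w - Int.fract s⌋ - ⌊s⌋ := by
      intro w
      rw [← Int.floor_sub_intCast]
      congr 1
      have := Int.floor_add_fract s
      linarith
    simp only [Function.update_self] at h1 ⊢
    rw [e] at h1 ⊢
    rw [← hy]; exact h1
  · have := h.mem (Function.update x j y) k
    simp only [Function.update_of_ne hk] at this ⊢
    exact this

lemma two_periods (f : ℝ → ℝ) (b b' : ℝ) (hb : 0 ≤ b) (hb1 : b < 1) (hb' : 0 ≤ b') (hb1' : b' < 1)
    (hne : b ≠ b') (h : ∀ y y', ⌊y - b⌋ = ⌊y' - b⌋ → f y = f y')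
    (h' : ∀ y y', ⌊y - b'⌋ = ⌊y' - b'⌋ → f y = f y') (y : ℝ) : f (y + 1) = f y := by
  wlog hlt : b < b' generalizing b b'
  · exact this b' b hb' hb1' hb hb1 hne.symm h' h (lt_of_le_of_ne (not_lt.1 hlt) hne.symm)
  have e1 : f y = f (b' + ⌊y - b⌋) := by
    apply h
    symm
    rw [Int.floor_eq_iff]; constructor <;> linarith
  have e2 : f (b' + ⌊y - b⌋) = f (b + ⌊y - b⌋ + 1) := by
    apply h'
    trans ⌊y - b⌋
    · simp
    · symm
      rw [Int.floor_eq_iff]; constructor <;> linarith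
  have e3 : f (b + ⌊y - b⌋ + 1) = f (y + 1) := by
    apply h
    have a1 := Int.floor_le (y - b)
    have a2 := Int.lt_floor_add_one (y - b)
    trans ⌊y - b⌋ + 1
    · rw [Int.floor_eq_iff]; push_cast; constructor <;> linarith
    · symm
      rw [Int.floor_eq_iff]; push_cast; constructor <;> linarith
  rw [e1, e2, e3]

lemma TauLaw.plane (h : TauLaw n τ) (hn : 2 ≤ n) (x : Fin d → ℝ) (i j : Fin d) (hij : i ≠ j)
    (r : ℝ) (hr : Int.fract (τ (Function.update x i r) j) ≠ Int.fract (τ x j)) (y : ℝ) :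
    Int.fract (τ (Function.update x j (y + 1)) i) = Int.fract (τ (Function.update x j y) i) := by
  refine two_periods (fun y => Int.fract (τ (Function.update x j y) i)) _ _
    (Int.fract_nonneg _) (Int.fract_lt_one _) (Int.fract_nonneg _) (Int.fract_lt_one _) hr ?_ ?_ y
  · intro y y' hy
    have := h.const hn _ j _ _ hy
    have l1 := h.line hn (Function.update x j y) i r
    have l2 := h.line hn (Function.update x j y') i r
    rw [← l1, ← l2, Function.update_comm hij.symm, Function.update_comm hij.symm, this]
  · intro y y' hy
    have := h.const hn _ j _ _ hy
    rw [this]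

lemma TauLaw.same (h : TauLaw n τ) (x y : Fin d → ℝ) (i : Fin d) (hxy : x i = y i)
    (hf : Int.fract (τ x i) = Int.fract (τ y i)) : ∃ m : ℤ, τ x i = τ y i + n * m := by
  obtain ⟨z, hz⟩ := Int.fract_eq_fract.1 hf
  have h1 := h.mem x i
  have h2 := h.mem y i
  have : y i - τ y i = x i - τ x i + z := by rw [← hz, hxy]; ring
  rw [this, Int.floor_add_intCast] at h2
  obtain ⟨m, hm⟩ := (Int.dvd_add_right h1).1 h2
  refine ⟨m, ?_⟩
  rw [hm] at hz
  push_cast at hz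
  linarith

/-- the integer point with residues `z` -/
noncomputable def gpt (z : Fin d → ZMod n) : Fin d → ℝ := fun i => ((z i).val : ℝ)

/-- shift by a basis vector -/
def shf (i : Fin d) (z : Fin d → ZMod n) : Fin d → ZMod n := z + Pi.single i 1

lemma shf_bij (i : Fin d) : Function.Bijective (shf (n := n) i) :=
  (Equiv.addRight (Pi.single i 1 : Fin d → ZMod n)).bijective

lemma gpt_shf_ne (i k : Fin d) (hk : k ≠ i) (z : Fin d → ZMod n) :
    gpt (shf i z) k = gpt z k := by
  simp [gpt, shf, hk]

lemma gpt_shf_eq (i : Fin d) (z : Fin d → ZMod n) :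
    gpt (shf i z) = Function.update (gpt z) i (gpt (shf i z) i) := by
  ext k
  by_cases hk : k = i
  · subst hk; simp
  · rw [gpt_shf_ne i k hk, Function.update_of_ne hk]

lemma TauLaw.tau_shf (h : TauLaw n τ) (hn : 2 ≤ n) (i : Fin d) (z : Fin d → ZMod n) :
    τ (gpt (shf i z)) = τ (Function.update (gpt z) i (gpt z i + 1)) := by
  have : NeZero n := ⟨by omega⟩
  apply h.uniq
  intro k
  have hm := h.mem (Function.update (gpt z) i (gpt z i + 1)) k
  by_cases hk : k = i
  · subst hk
    have : ((((z k + 1).val : ℕ) : ℤ) : ZMod n) = (((z k).val + 1 : ℤ) : ZMod n) := by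
      simp
    rw [ZMod.intCast_eq_intCast_iff_dvd_sub] at this
    obtain ⟨m, hm'⟩ := this
    refine dvd_floor_shift n _ _ (-m) ?_ hm
    have hm'' : (((z k).val : ℝ) + 1 - ((z k + 1).val : ℝ)) = n * m := by exact_mod_cast hm'
    simp only [Function.update_self, gpt, shf, Pi.add_apply, Pi.single_eq_same]
    push_cast
    linarith
  · rw [gpt_shf_ne i k hk]
    simpa only [Function.update_of_ne hk] using hm

lemma TauLaw.surj (h : TauLaw n τ) (hn : 2 ≤ n) (x : Fin d → ℝ) :
    ∃ z : Fin d → ZMod n, τ (gpt z) = τ x := by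
  have : NeZero n := ⟨by omega⟩
  refine ⟨fun i => ((⌈τ x i⌉ : ℤ) : ZMod n), ?_⟩
  apply h.uniq
  intro i
  have : ((((((⌈τ x i⌉ : ℤ) : ZMod n)).val : ℕ) : ℤ) : ZMod n) = ((⌈τ x i⌉ : ℤ) : ZMod n) := by
    simp
  rw [ZMod.intCast_eq_intCast_iff_dvd_sub] at this
  obtain ⟨m, hm⟩ := this
  have hm' : (⌈τ x i⌉ : ℝ) - ((((⌈τ x i⌉ : ℤ) : ZMod n)).val : ℝ) = n * m := by exact_mod_cast hm
  refine dvd_floor_shift n _ (⌈τ x i⌉ - τ x i) (-m) ?_ ?_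
  · simp only [gpt]; push_cast; linarith
  · have : ⌊(⌈τ x i⌉ : ℝ) - τ x i⌋ = 0 := by
      rw [Int.floor_eq_iff]
      have := Int.le_ceil (τ x i)
      have := Int.ceil_lt_add_one (τ x i)
      constructor <;> push_cast <;> linarith
    rw [this]; simp

/-- the vectors -/
noncomputable def vecV (τ : (Fin d → ℝ) → (Fin d → ℝ)) (w : ℂ) (i : Fin d) (a : ℝ)
    (z : Fin d → ZMod n) : ℂ :=
  if Int.fract (τ (gpt z) i) = a then w ^ ⌊τ (gpt z) i⌋ else 0

lemma vecV_self (h : TauLaw n τ) (hn : 2 ≤ n) (w : ℂ) (hw : w ^ n = 1) (i : Fin d) (a : ℝ)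
    (z : Fin d → ZMod n) : vecV τ w i a (shf i z) = w * vecV τ w i a z := by
  have hw0 : w ≠ 0 := by rintro rfl; rw [zero_pow (by omega)] at hw; exact zero_ne_one hw
  obtain ⟨m, hm⟩ := h.step hn (gpt z) i
  unfold vecV
  rw [h.tau_shf hn, hm]
  have : τ (gpt z) i + 1 + n * m = τ (gpt z) i + ((1 + n * m : ℤ) : ℝ) := by push_cast; ring
  rw [this, Int.fract_add_intCast, Int.floor_add_intCast]
  split_ifs
  · rw [zpow_add₀ hw0, zpow_add₀ hw0, zpow_mul, zpow_natCast, hw]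
    simp [mul_comm]
  · simp

lemma vecV_other (h : TauLaw n τ) (hn : 2 ≤ n) (w : ℂ) (hw : w ^ n = 1) (i j : Fin d) (hij : i ≠ j)
    (a : ℝ) (z : Fin d → ZMod n)
    (hf : Int.fract (τ (gpt (shf j z)) i) = Int.fract (τ (gpt z) i)) :
    vecV τ w i a (shf j z) = vecV τ w i a z := by
  have hw0 : w ≠ 0 := by rintro rfl; rw [zero_pow (by omega)] at hw; exact zero_ne_one hw
  obtain ⟨m, hm⟩ := h.same _ _ i (gpt_shf_ne j i hij z) hf
  unfold vecV
  rw [hf, hm]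
  have : τ (gpt z) i + n * m = τ (gpt z) i + ((n * m : ℤ) : ℝ) := by push_cast; ring
  rw [this, Int.floor_add_intCast, zpow_add₀ hw0, zpow_mul, zpow_natCast, hw]
  simp

lemma sum_zero_of_shift [NeZero n] (i : Fin d) (g : (Fin d → ZMod n) → ℂ) (c : ℂ) (hc : c ≠ 1)
    (hg : ∀ z, g (shf i z) = c * g z) : ∑ z, g z = 0 := by
  have h1 : ∑ z, g (shf i z) = ∑ z, g z := (shf_bij i).sum_comp g
  simp only [hg] at h1
  rw [← Finset.mul_sum] at h1
  have : (c - 1) * ∑ z, g z = 0 := by rw [sub_mul, h1]; ring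
  exact (mul_eq_zero.1 this).resolve_left (sub_ne_zero.2 hc)

lemma conj_ne_one {w : ℂ} (hw : w ≠ 1) : (starRingEnd ℂ) w ≠ 1 := by
  intro h
  apply hw
  have := congrArg (starRingEnd ℂ) h
  simpa using this

lemma orth_ne [NeZero n] (h : TauLaw n τ) (hn : 2 ≤ n) (w w' : ℂ) (hw : w ^ n = 1)
    (hw' : w' ^ n = 1) (h1 : w ≠ 1) (h1' : w' ≠ 1) (i j : Fin d) (hij : i ≠ j) (a b : ℝ) :
    ∑ z : Fin d → ZMod n, (starRingEnd ℂ) (vecV τ w i a z) * vecV τ w' j b z = 0 := by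
  classical
  let K : (Fin d → ZMod n) → Prop := fun z => ∀ y, 
    Int.fract (τ (Function.update (gpt z) j (y + 1)) i) =
      Int.fract (τ (Function.update (gpt z) j y) i)
  have Kj : ∀ z, K (shf j z) ↔ K z := by
    intro z
    simp only [K]
    rw [gpt_shf_eq j z]
    simp only [Function.update_idem]
  have Ki : ∀ z, K (shf i z) ↔ K z := by
    intro z
    simp only [K]
    rw [gpt_shf_eq i z]
    simp only [Function.update_comm hij, h.line hn]
  set g : (Fin d → ZMod n) → ℂ :=
    fun z => (starRingEnd ℂ) (vecV τ w i a z) * vecV τ w' j b z with hg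
  have s1 : ∑ z, (if K z then g z else 0) = 0 := by
    apply sum_zero_of_shift j _ w' h1'
    intro z
    simp only [Kj]
    split_ifs with hK
    · have hf : Int.fract (τ (gpt (shf j z)) i) = Int.fract (τ (gpt z) i) := by
        rw [h.tau_shf hn, hK, Function.update_eq_self]
      simp only [hg]
      rw [vecV_self h hn w' hw', vecV_other h hn w hw i j hij a z hf]
      ring
    · simp
  have s2 : ∑ z, (if K z then 0 else g z) = 0 := by
    apply sum_zero_of_shift i _ _ (conj_ne_one h1)
    intro z
    simp only [Ki]
    split_ifs with hK
    · simp
    · have hf : Int.fract (τ (gpt (shf i z)) j) = Int.fract (τ (gpt z) j) := by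
        by_contra hne
        apply hK
        rw [h.tau_shf hn] at hne
        exact h.plane hn _ i j hij _ hne
      simp only [hg]
      rw [vecV_self h hn w hw, vecV_other h hn w' hw' j i hij.symm b z hf, map_mul]
      ring
  have : ∑ z, g z = ∑ z, (if K z then g z else 0) + ∑ z, (if K z then 0 else g z) := by
    rw [← Finset.sum_add_distrib]
    apply Finset.sum_congr rfl
    intro z _
    split_ifs <;> simp
  rw [this, s1, s2, add_zero]

lemma orth_one [NeZero n] (h : TauLaw n τ) (hn : 2 ≤ n) (w : ℂ) (hw : w ^ n = 1)
    (h1 : w ≠ 1) (i : Fin d) (a : ℝ) :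
    ∑ z : Fin d → ZMod n, vecV τ w i a z = 0 :=
  sum_zero_of_shift i _ w h1 (vecV_self h hn w hw i a)

lemma orth_same [NeZero n] (h : TauLaw n τ) (hn : 2 ≤ n) (w w' : ℂ) (hw : w ^ n = 1)
    (hw' : w' ^ n = 1) (i : Fin d) (a b : ℝ) (hne : a ≠ b ∨ w ≠ w') :
    ∑ z : Fin d → ZMod n, (starRingEnd ℂ) (vecV τ w i a z) * vecV τ w' i b z = 0 := by
  by_cases hab : a = b
  · have hww : w ≠ w' := hne.resolve_left (not_not.2 hab)
    refine sum_zero_of_shift i _ ((starRingEnd ℂ) w * w') ?_ ?_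
    · intro e
      apply hww
      have hn1 : ‖w‖ = 1 := Complex.norm_eq_one_of_pow_eq_one hw (by omega)
      have : w * (starRingEnd ℂ) w = 1 := by
        rw [Complex.mul_conj, Complex.normSq_eq_norm_sq, hn1]; simp
      calc w = w * ((starRingEnd ℂ) w * w') := by rw [e, mul_one]
        _ = w' := by rw [← mul_assoc, this, one_mul]
    · intro z
      rw [vecV_self h hn w hw, vecV_self h hn w' hw', map_mul]
      ring
  · apply Finset.sum_eq_zero
    intro z _
    unfold vecV
    split_ifs with e1 e2
    · exact absurd (e1.symm.trans e2) hab
    · simp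
    · simp
    · simp

end

theorem stmt_8 {d : ℕ} (n : ℕ) (hn : 2 ≤ n) (T : Set (Fin d → ℝ))
    (hT : IsCubeTiling (fun _ : Fin d => n) T) :
    ∑ i : Fin d, (pset T i).ncard ≤ (n ^ d - 1) / (n - 1) := by
  classical
  have : NeZero n := ⟨by omega⟩
  obtain ⟨τ, h, rfl⟩ := exists_tau n hn T hT
  let P : Fin d → Finset ℝ := fun i =>
    Finset.univ.image (fun z : Fin d → ZMod n => Int.fract (τ (gpt z) i))
  have hP : ∀ i, pset (Set.range τ) i = (P i : Set ℝ) := by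
    intro i
    ext a
    simp only [pset, P, Set.mem_image, Set.mem_range, Finset.coe_image, Finset.coe_univ,
      Set.image_univ]
    constructor
    · rintro ⟨_, ⟨x, rfl⟩, rfl⟩
      obtain ⟨z, hz⟩ := h.surj hn x
      exact ⟨z, by rw [hz]⟩
    · rintro ⟨z, rfl⟩
      exact ⟨_, ⟨_, rfl⟩, rfl⟩
  simp only [hP, Set.ncard_coe_finset]
  set ω : ℂ := Complex.exp (2 * Real.pi * Complex.I / n) with hω
  have hprim : IsPrimitiveRoot ω n := Complex.isPrimitiveRoot_exp n (by omega)
  let W : Fin (n - 1) → ℂ := fun k => ω ^ (k.1 + 1)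
  have hWn : ∀ k, W k ^ n = 1 := by
    intro k
    simp only [W]
    rw [← pow_mul, mul_comm, pow_mul, hprim.pow_eq_one, one_pow]
  have hW1 : ∀ k, W k ≠ 1 := fun k =>
    hprim.pow_ne_one_of_pos_of_lt (by omega) (by have := k.2; omega)
  have hWinj : ∀ k l, W k = W l → k = l := by
    intro k l hkl
    have := hprim.pow_inj (by have := k.2; omega) (by have := l.2; omega) hkl
    ext; omega
  let v : Option (Σ i : Fin d, (P i) × Fin (n - 1)) → EuclideanSpace ℂ (Fin d → ZMod n) :=
    fun o => match o with
    | none => WithLp.toLp 2 (fun _ => 1)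
    | some ⟨i, a, k⟩ => WithLp.toLp 2 (vecV τ (W k) i a)
  have hinner : ∀ f g : (Fin d → ZMod n) → ℂ,
      inner ℂ (WithLp.toLp 2 f) (WithLp.toLp 2 g) = ∑ z, (starRingEnd ℂ) (f z) * g z := by
    intro f g
    simp [PiLp.inner_apply, mul_comm]
  have hli : LinearIndependent ℂ v := by
    apply linearIndependent_of_ne_zero_of_inner_eq_zero
    · rintro (_ | ⟨i, a, k⟩) h0
      · have := congrArg (fun f : EuclideanSpace ℂ (Fin d → ZMod n) => f 0) h0
        simp [v] at this
      · obtain ⟨a, ha⟩ := a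
        obtain ⟨z, -, hz⟩ := Finset.mem_image.1 ha
        have := congrArg (fun f : EuclideanSpace ℂ (Fin d → ZMod n) => f z) h0
        simp only [v, vecV, hz, if_true, PiLp.zero_apply] at this
        have hw0 : W k ≠ 0 := by
          intro e
          have := hWn k
          rw [e, zero_pow (by omega)] at this
          exact zero_ne_one this
        exact zpow_ne_zero _ hw0 this
    · rintro (_ | ⟨i, a, k⟩) (_ | ⟨j, b, l⟩) hne
      · exact absurd rfl hne
      · simp only [v]
        rw [hinner]
        simpa using orth_one h hn (W l) (hWn l) (hW1 l) j b
      · simp only [v]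
        rw [hinner]
        have := congrArg (starRingEnd ℂ) (orth_one h hn (W k) (hWn k) (hW1 k) i a)
        simpa using this
      · simp only [v]
        rw [hinner]
        by_cases hij : i = j
        · subst hij
          apply orth_same h hn _ _ (hWn k) (hWn l)
          by_contra hcon
          push Not at hcon
          apply hne
          rw [Subtype.ext hcon.1, hWinj _ _ hcon.2]
        · exact orth_ne h hn _ _ (hWn k) (hWn l) (hW1 k) (hW1 l) i j hij a b
  have hcard := hli.fintype_card_le_finrank
  rw [finrank_euclideanSpace] at hcard
  simp only [Fintype.card_option, Fintype.card_sigma, Fintype.card_prod, Fintype.card_coe,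
    Fintype.card_fin, Fintype.card_pi, ZMod.card, Finset.prod_const, Finset.card_univ] at hcard
  rw [Nat.le_div_iff_mul_le (by omega), Finset.sum_mul]
  omega
end
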